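/- arXiv:2110.15496 — 5 statements merged into one kernel-verified Lean document; each statement's English description precedes it below -/
import Mathlib

section
/- Let X be a Tychonoff (completely regular Hausdorff) topological space. Then the function space B_1(X) is meager in itself if and only if there exists a pairwise disjoint sequence {Δ_n : n ∈ ℕ} of nonempty finite subsets of X such that sup_{n ∈ ℕ} ( min { |f(x)| : x ∈ Δ_n } ) < ∞ for every Baire-one function f ∈ B_1(X). -/
open Set Topology Filter

/-- A real-valued function on a topological space is *Baire-one* if it is the
pointwise limit of a sequence of continuous real-valued functions. -/
def BaireOne {X : Type*} [TopologicalSpace X] (f : X → ℝ) : Prop :=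
  ∃ g : ℕ → X → ℝ, (∀ n, Continuous (g n)) ∧
    ∀ x, Filter.Tendsto (fun n => g n x) Filter.atTop (nhds (f x))

/-- A *zero-set* is the preimage of `{0}` under a continuous real-valued function. -/
def IsZeroSet {X : Type*} [TopologicalSpace X] (s : Set X) : Prop :=
  ∃ f : X → ℝ, Continuous f ∧ s = f ⁻¹' {0}

/-- A *cozero-set* is the complement of a zero-set. -/
def IsCozeroSet {X : Type*} [TopologicalSpace X] (s : Set X) : Prop :=
  IsZeroSet sᶜ

/-- A *Coz_δ-set* is a countable intersection of cozero-sets. -/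
def IsCozDelta {X : Type*} [TopologicalSpace X] (s : Set X) : Prop :=
  ∃ F : ℕ → Set X, (∀ n, IsCozeroSet (F n)) ∧ s = ⋂ n, F n

/-- A *Zer_σ-set* is a countable union of zero-sets. -/
def IsZerSigma {X : Type*} [TopologicalSpace X] (s : Set X) : Prop :=
  ∃ F : ℕ → Set X, (∀ n, IsZeroSet (F n)) ∧ s = ⋃ n, F n

/-- A family of Coz_δ-subsets is *completely Coz_δ-additive* if the union of every
subfamily is a Coz_δ-set. -/
def CompletelyCozDeltaAdditive {X : Type*} [TopologicalSpace X] {ι : Type*}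
    (F : ι → Set X) : Prop :=
  (∀ i, IsCozDelta (F i)) ∧ ∀ S : Set ι, IsCozDelta (⋃ i ∈ S, F i)

/-- A set `A ⊆ X` is *strongly Coz_δ-disjoint* if there is a pairwise disjoint,
completely Coz_δ-additive family of Coz_δ-sets `F a` with `a ∈ F a` for every `a ∈ A`. -/
def StronglyCozDeltaDisjoint {X : Type*} [TopologicalSpace X] (A : Set X) : Prop :=
  ∃ F : A → Set X, (∀ a : A, (a : X) ∈ F a) ∧
    (Pairwise fun a b : A => Disjoint (F a) (F b)) ∧
    CompletelyCozDeltaAdditive F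

section BaireOneCategory

variable {X : Type*}

theorem isOpen_setOf_abs_sub_lt (p : (X → ℝ) → Prop) (K : Finset X) (u : X → ℝ) (δ : ℝ) :
    IsOpen {v : {f : X → ℝ // p f} | ∀ x ∈ K, |v.1 x - u x| < δ} := by
  have : {v : {f : X → ℝ // p f} | ∀ x ∈ K, |v.1 x - u x| < δ} =
      ⋂ x ∈ K, {v : {f : X → ℝ // p f} | |v.1 x - u x| < δ} := by
    ext; simp
  rw [this]
  refine isOpen_biInter_finset fun x _ => isOpen_lt ?_ continuous_const
  exact (((continuous_apply x).comp continuous_subtype_val).sub continuous_const).abs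

theorem exists_finset_of_mem_nhds {p : (X → ℝ) → Prop} {u : {f : X → ℝ // p f}}
    {U : Set {f : X → ℝ // p f}} (hU : U ∈ 𝓝 u) :
    ∃ (K : Finset X) (δ : ℝ), 0 < δ ∧
      ∀ v : {f : X → ℝ // p f}, (∀ x ∈ K, |v.1 x - u.1 x| < δ) → v ∈ U := by
  rw [nhds_subtype_eq_comap, nhds_pi, mem_comap] at hU
  obtain ⟨t, ht, htU⟩ := hU
  obtain ⟨⟨I, r⟩, ⟨hI, hr⟩, hIr⟩ :=
    (Filter.hasBasis_pi fun x => Metric.nhds_basis_ball (x := u.1 x)).mem_iff.1 ht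
  have hev : ∀ᶠ δ : ℝ in 𝓝[>] 0, ∀ x ∈ I, δ < r x :=
    (Filter.eventually_all_finite hI).2 fun x hx =>
      mem_nhdsWithin_of_mem_nhds (Iio_mem_nhds (hr x hx))
  obtain ⟨δ, hδ, hδ0⟩ := (hev.and self_mem_nhdsWithin).exists
  refine ⟨hI.toFinset, δ, hδ0, fun v hv => htU (hIr fun x hx => ?_)⟩
  rw [Metric.mem_ball, Real.dist_eq]
  exact (hv x (hI.mem_toFinset.2 hx)).trans (hδ x hx)

theorem exists_disjoint_finset_of_pairwise_disjoint {Δ : ℕ → Set X}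
    (hΔ : Pairwise fun n m => Disjoint (Δ n) (Δ m)) (K : Finset X) :
    ∃ n, ∀ x ∈ Δ n, x ∉ K := by
  by_contra! h
  choose x hx hxK using h
  obtain ⟨n, m, hnm, he⟩ := Finite.exists_ne_map_eq_of_infinite fun n => (⟨x n, hxK n⟩ : K)
  have he : x n = x m := congrArg Subtype.val he
  exact Set.disjoint_left.1 (hΔ hnm) (hx n) (he ▸ hx m)

variable [TopologicalSpace X]

theorem BaireOne.of_continuous {f : X → ℝ} (hf : Continuous f) : BaireOne f :=
  ⟨fun _ => f, fun _ => hf, fun _ => tendsto_const_nhds⟩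

/-- Substituting a Baire-one function into a jointly continuous one gives a Baire-one function. -/
theorem BaireOne.continuous_comp {f : X → ℝ} (hf : BaireOne f) {H : X × ℝ → ℝ}
    (hH : Continuous H) : BaireOne fun x => H (x, f x) := by
  obtain ⟨g, hg, hgf⟩ := hf
  refine ⟨fun n x => H (x, g n x), fun n => hH.comp (continuous_id.prodMk (hg n)), fun x => ?_⟩
  exact ((hH.comp (Continuous.prodMk_right x)).tendsto (f x)).comp (hgf x)

theorem BaireOne.add_continuous {f g : X → ℝ} (hf : BaireOne f) (hg : Continuous g) :
    BaireOne fun x => f x + g x :=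
  hf.continuous_comp (H := fun z => z.2 + g z.1) (by fun_prop)

theorem BaireOne.abs {f : X → ℝ} (hf : BaireOne f) : BaireOne fun x => |f x| :=
  hf.continuous_comp (H := fun z => |z.2|) (by fun_prop)

theorem Finset.exists_continuous_eqOn [T35Space X] (K : Finset X) (w : X → ℝ) :
    ∃ g : X → ℝ, Continuous g ∧ ∀ x ∈ K, g x = w x := by
  classical
  induction K using Finset.induction_on with
  | empty => exact ⟨0, continuous_zero, by simp⟩
  | insert a K ha ih =>
    obtain ⟨g, hg, hgw⟩ := ih
    obtain ⟨e, he, hea, heK⟩ := CompletelyRegularSpace.completely_regular a (K : Set X)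
      K.finite_toSet.isClosed (by simpa using ha)
    refine ⟨fun x => g x + (w a - g a) * (1 - (e x : ℝ)), by fun_prop, fun x hx => ?_⟩
    rcases Finset.mem_insert.1 hx with rfl | hx
    · simp [hea]
    · simp [heK hx, hgw x hx]

theorem Finset.exists_continuous_eqOn_abs_le [T35Space X] (K : Finset X) (w : X → ℝ) {ε : ℝ}
    (hε : 0 ≤ ε) (hw : ∀ x ∈ K, |w x| ≤ ε) :
    ∃ g : X → ℝ, Continuous g ∧ (∀ x ∈ K, g x = w x) ∧ ∀ x, |g x| ≤ ε := by
  obtain ⟨g, hg, hgw⟩ := K.exists_continuous_eqOn w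
  refine ⟨fun x => max (-ε) (min ε (g x)), by fun_prop, fun x hx => ?_, fun x => ?_⟩
  · have := abs_le.1 (hw x hx)
    simp only [hgw x hx]
    rw [min_eq_right this.2, max_eq_right this.1]
  · exact abs_le.2 ⟨le_max_left _ _, max_le (by linarith) (min_le_left _ _)⟩

theorem Finset.exists_bounded_continuous_eqOn [T35Space X] (K : Finset X) (w : X → ℝ) :
    ∃ (g : X → ℝ) (B : ℝ), Continuous g ∧ (∀ x ∈ K, g x = w x) ∧ ∀ x, |g x| ≤ B := by
  have hB : ∀ x ∈ K, |w x| ≤ ∑ y ∈ K, |w y| := fun x hx =>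
    Finset.single_le_sum (f := fun y => |w y|) (fun _ _ => abs_nonneg _) hx
  obtain ⟨g, hg⟩ := K.exists_continuous_eqOn_abs_le w
    (Finset.sum_nonneg fun _ _ => abs_nonneg _) hB
  exact ⟨g, _, hg⟩

theorem isMeagre_univ_of_bounded_min [T35Space X] {Δ : ℕ → Set X}
    (hfin : ∀ n, (Δ n).Finite) (hdisj : Pairwise fun n m => Disjoint (Δ n) (Δ m))
    (hbdd : ∀ f : X → ℝ, BaireOne f → ∃ M : ℝ, ∀ n, ∃ x ∈ Δ n, |f x| ≤ M) :
    IsMeagre (Set.univ : Set {f : X → ℝ // BaireOne f}) := by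
  classical
  have hcover : (Set.univ : Set {f : X → ℝ // BaireOne f}) =
      ⋃ M : ℕ, {f | ∀ n, ∃ x ∈ Δ n, |f.1 x| ≤ (M : ℝ)} := by
    refine (Set.eq_univ_of_forall fun f => ?_).symm
    obtain ⟨M, hM⟩ := hbdd f.1 f.2
    obtain ⟨N, hN⟩ := exists_nat_ge M
    refine Set.mem_iUnion.2 ⟨N, fun n => ?_⟩
    obtain ⟨x, hx, hxM⟩ := hM n
    exact ⟨x, hx, hxM.trans hN⟩
  rw [hcover]
  refine isMeagre_iUnion fun M => IsNowhereDense.isMeagre ?_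
  have hclosed : IsClosed {f : {f : X → ℝ // BaireOne f} | ∀ n, ∃ x ∈ Δ n, |f.1 x| ≤ (M : ℝ)} := by
    have : {f : {f : X → ℝ // BaireOne f} | ∀ n, ∃ x ∈ Δ n, |f.1 x| ≤ (M : ℝ)} =
        ⋂ n, ⋃ x ∈ Δ n, {f : {f : X → ℝ // BaireOne f} | |f.1 x| ≤ (M : ℝ)} := by
      ext; simp
    rw [this]
    refine isClosed_iInter fun n => (hfin n).isClosed_biUnion fun x _ => ?_
    exact isClosed_le ((continuous_apply x).comp continuous_subtype_val).abs continuous_const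
  rw [hclosed.isNowhereDense_iff]
  refine Set.eq_empty_of_forall_notMem fun f hf => ?_
  obtain ⟨K, δ, hδ, hK⟩ := exists_finset_of_mem_nhds (mem_interior_iff_mem_nhds.1 hf)
  obtain ⟨n, hn⟩ := exists_disjoint_finset_of_pairwise_disjoint hdisj K
  obtain ⟨g, hg, hgw⟩ := (K ∪ (hfin n).toFinset).exists_continuous_eqOn
    fun x => if x ∈ K then 0 else M + 1 - f.1 x
  obtain ⟨x, hx, hxM⟩ := hK ⟨_, f.2.add_continuous hg⟩ (fun x hx => by
    simpa [hgw x (by simp [hx]), hx] using hδ) n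
  simp only [hgw x (by simp [hx]), hn x hx, if_false] at hxM
  have := le_abs_self (f.1 x + (M + 1 - f.1 x))
  linarith

theorem exists_antitone_dense_open_of_isMeagre_univ {Y : Type*} [TopologicalSpace Y]
    (h : IsMeagre (Set.univ : Set Y)) :
    ∃ U : ℕ → Set Y, (∀ n, IsOpen (U n)) ∧ (∀ n, Dense (U n)) ∧ Antitone U ∧
      ⋂ n, U n = ∅ := by
  rw [IsMeagre, Set.compl_univ, mem_residual_iff] at h
  obtain ⟨S, hSo, hSd, hSc, hS⟩ := h
  obtain ⟨V, hV⟩ := (hSc.insert Set.univ).exists_eq_range (Set.insert_nonempty _ _)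
  have hVp : ∀ n, IsOpen (V n) ∧ Dense (V n) := fun n => by
    have : V n ∈ insert Set.univ S := hV ▸ Set.mem_range_self n
    rcases this with h | h
    · exact h ▸ ⟨isOpen_univ, dense_univ⟩
    · exact ⟨hSo _ h, hSd _ h⟩
  have hW : ∀ n, IsOpen (⋂ i ∈ Finset.range n, V i) ∧ Dense (⋂ i ∈ Finset.range n, V i) := by
    intro n
    induction n with
    | zero => simp
    | succ n ih =>
      have : ⋂ i ∈ Finset.range (n + 1), V i = V n ∩ ⋂ i ∈ Finset.range n, V i := by
        rw [Finset.range_add_one, Finset.set_biInter_insert]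
      rw [this]
      exact ⟨(hVp n).1.inter ih.1, (hVp n).2.inter_of_isOpen_left ih.2 (hVp n).1⟩
  refine ⟨fun n => ⋂ i ∈ Finset.range n, V i, fun n => (hW n).1, fun n => (hW n).2,
    fun n m hnm => Set.biInter_subset_biInter_left fun i hi => ?_, ?_⟩
  · exact Finset.range_subset_range.2 hnm hi
  · refine Set.eq_empty_of_forall_notMem fun y hy => hS (a := y) fun t ht => ?_
    obtain ⟨i, rfl⟩ : t ∈ Set.range V := hV ▸ Set.mem_insert_of_mem _ ht
    exact Set.mem_iInter₂.1 (Set.mem_iInter.1 hy (i + 1)) i (by simp)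

/-- A dense open set of Baire-one functions is, over any finite set of points, approximately
reachable from all functions bounded by a given constant using a single larger finite set. -/
theorem exists_finset_uniform_approx [T35Space X] [Infinite X]
    {U : Set {f : X → ℝ // BaireOne f}} (hUo : IsOpen U) (hUd : Dense U) (K : Finset X)
    (B : ℝ) {ε : ℝ} (hε : 0 < ε) :
    ∃ K' : Finset X, K ⊂ K' ∧ ∀ p : X → ℝ, (∀ x, |p x| ≤ B) →
      ∃ (u : X → ℝ) (δ : ℝ), 0 < δ ∧ (∀ x ∈ K, |u x - p x| < ε) ∧
        ∀ v : {f : X → ℝ // BaireOne f}, (∀ x ∈ K', |v.1 x - u x| < δ) → v ∈ U := by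
  classical
  have hex : ∀ p : X → ℝ, ∃ u ∈ U, ∀ x ∈ K, |u.1 x - p x| < ε := fun p => by
    obtain ⟨g, hg, hgp⟩ := K.exists_continuous_eqOn p
    obtain ⟨u, hu, huU⟩ := hUd.inter_open_nonempty _ (isOpen_setOf_abs_sub_lt BaireOne K p ε)
      ⟨⟨g, .of_continuous hg⟩, fun x hx => by simpa [hgp x hx] using hε⟩
    exact ⟨u, huU, hu⟩
  choose u huU hu using hex
  choose A δ hδ hA using fun p => exists_finset_of_mem_nhds (hUo.mem_nhds (huU p))
  have hcompact : IsCompact (Set.pi Set.univ fun _ : X => Set.Icc (-B) B) :=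
    isCompact_univ_pi fun _ => isCompact_Icc
  obtain ⟨t, -, ht⟩ := hcompact.elim_nhds_subcover
    (fun p => {q : X → ℝ | ∀ x ∈ K, |(u p).1 x - q x| < ε}) fun p _ => by
      refine IsOpen.mem_nhds ?_ (hu p)
      have : {q : X → ℝ | ∀ x ∈ K, |(u p).1 x - q x| < ε} =
          ⋂ x ∈ K, {q : X → ℝ | |(u p).1 x - q x| < ε} := by
        ext; simp
      rw [this]
      exact isOpen_biInter_finset fun x _ =>
        isOpen_lt (continuous_const.sub (continuous_apply x)).abs continuous_const
  obtain ⟨a, ha⟩ := Infinite.exists_notMem_finset K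
  refine ⟨insert a (K ∪ t.biUnion A), ?_, fun p hp => ?_⟩
  · refine Finset.ssubset_iff_subset_ne.2 ⟨fun x hx => by simp [hx], fun h => ha ?_⟩
    rw [h]; simp
  · obtain ⟨q, hq, hpq⟩ := Set.mem_iUnion₂.1 (ht fun x _ => abs_le.1 (hp x))
    refine ⟨(u q).1, δ q, hδ q, hpq, fun v hv => hA q v fun x hx => hv x ?_⟩
    simp only [Finset.mem_insert, Finset.mem_union, Finset.mem_biUnion]
    exact Or.inr (Or.inr ⟨q, hq, hx⟩)

theorem not_isMeagre_univ_of_finite [T35Space X] [Finite X] :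
    ¬ IsMeagre (Set.univ : Set {f : X → ℝ // BaireOne f}) := by
  have := Fintype.ofFinite X
  have hall : {f : X → ℝ | BaireOne f} = Set.univ :=
    Set.eq_univ_of_forall fun f => .of_continuous continuous_of_discreteTopology
  have hc : IsClosed {f : X → ℝ | BaireOne f} := hall ▸ isClosed_univ
  have : CompleteSpace {f : X → ℝ // BaireOne f} := hc.completeSpace_coe
  have : Nonempty {f : X → ℝ // BaireOne f} := ⟨⟨0, .of_continuous continuous_zero⟩⟩
  exact not_isMeagre_of_isOpen isOpen_univ Set.univ_nonempty

/-- If, for every `k`, the increments beyond stage `k` are dominated on `{t ≤ k}` by those of a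
null sequence, the sequence converges to a continuous function. -/
theorem exists_continuous_limit {H : ℕ → X × ℝ → ℝ} {ε : ℕ → ℝ} (hH : ∀ k, Continuous (H k))
    (hpos : ∀ k, 0 < ε k) (hε : Tendsto ε atTop (𝓝 0))
    (hstep : ∀ (k : ℕ) z, z.2 ≤ (k : ℝ) → |H (k + 1) z - H k z| ≤ ε k - ε (k + 1)) :
    ∃ L : X × ℝ → ℝ, Continuous L ∧ ∀ z, Tendsto (fun k => H k z) atTop (𝓝 (L z)) := by
  have htele : ∀ (k : ℕ) z, z.2 ≤ (k : ℝ) → ∀ j, k ≤ j → |H j z - H k z| ≤ ε k - ε j := by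
    intro k z hz j hj
    induction j, hj using Nat.le_induction with
    | base => simp
    | succ j hj ih =>
      have h1 := hstep j z (hz.trans (by exact_mod_cast hj))
      have h2 := abs_sub_le (H (j + 1) z) (H j z) (H k z)
      linarith
  have hlim : ∀ z, ∃ l, Tendsto (fun k => H k z) atTop (𝓝 l) := by
    intro z
    obtain ⟨N, hN⟩ := exists_nat_ge z.2
    refine cauchySeq_tendsto_of_complete (Metric.cauchySeq_iff'.2 fun r hr => ?_)
    obtain ⟨k, hk, hkN⟩ := ((hε.eventually_lt_const hr).and (eventually_ge_atTop N)).exists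
    refine ⟨k, fun j hj => ?_⟩
    rw [Real.dist_eq]
    have := htele k z (hN.trans (by exact_mod_cast hkN)) j hj
    linarith [hpos j]
  choose L hL using hlim
  refine ⟨L, ?_, hL⟩
  have hLH : ∀ (k : ℕ) z, z.2 ≤ (k : ℝ) → |L z - H k z| ≤ ε k := fun k z hz =>
    le_of_tendsto ((hL z).sub_const _).abs <| (eventually_ge_atTop k).mono fun j hj => by
      linarith [htele k z hz j hj, hpos j]
  refine continuous_iff_continuousAt.2 fun z =>
    continuousAt_of_locally_uniform_approx_of_continuousAt fun s hs => ?_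
  obtain ⟨r, hr, hrs⟩ := Metric.mem_uniformity_dist.1 hs
  obtain ⟨N, hN⟩ := exists_nat_gt z.2
  obtain ⟨k, hk, hkN⟩ := ((hε.eventually_lt_const hr).and (eventually_ge_atTop N)).exists
  refine ⟨{y | y.2 < (N : ℝ)}, (isOpen_lt continuous_snd continuous_const).mem_nhds hN, H k,
    (hH k).continuousAt, fun y hy => hrs ?_⟩
  rw [Real.dist_eq]
  exact (hLH k y ((le_of_lt hy).trans (by exact_mod_cast hkN))).trans_lt hk

/-- One correction step: over `K` the function moves by less than `η`, over `K' \ K` it is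
changed only where `t > k`, and along the graph of `f` over `K'` it takes the values `u`. -/
theorem exists_corrected_function [T35Space X] {K K' : Finset X} {f u : X → ℝ}
    {H : X × ℝ → ℝ} (hH : Continuous H) {B η : ℝ} (hB : ∀ z, |H z| ≤ B) (hη : 0 ≤ η) {k : ℝ}
    (hu : ∀ x ∈ K, |u x - H (x, f x)| ≤ η) (hKK' : K ⊆ K')
    (hf : ∀ x ∈ K', x ∉ K → k + 1 ≤ f x) :
    ∃ H' : X × ℝ → ℝ, Continuous H' ∧ (∃ B', ∀ z, |H' z| ≤ B') ∧
      (∀ z, z.2 ≤ k → |H' z - H z| ≤ η) ∧ (∀ x ∈ K, ∀ t, |H' (x, t) - H (x, t)| ≤ η) ∧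
      ∀ x ∈ K', H' (x, f x) = u x := by
  obtain ⟨s, hs, hsK, hsη⟩ := K.exists_continuous_eqOn_abs_le
    (fun x => u x - H (x, f x)) hη hu
  obtain ⟨φ, C, hφ, hφK, hφC⟩ := K'.exists_bounded_continuous_eqOn
    fun x => u x - H (x, f x) - s x
  have hφ0 : ∀ x ∈ K, φ x = 0 := fun x hx => by rw [hφK x (hKK' hx), hsK x hx, sub_self]
  refine ⟨fun z => H z + s z.1 + max 0 (min 1 (z.2 - k)) * φ z.1, by fun_prop,
    ⟨B + η + C, fun z => ?_⟩, fun z hz => ?_, fun x hx t => ?_, fun x hx => ?_⟩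
  · have h1 : |max 0 (min 1 (z.2 - k)) * φ z.1| ≤ C := by
      rw [abs_mul, abs_of_nonneg (le_max_left _ _)]
      have : max 0 (min 1 (z.2 - k)) ≤ 1 := max_le zero_le_one (min_le_left _ _)
      nlinarith [hφC z.1, abs_nonneg (φ z.1)]
    have h2 := abs_add_three (H z) (s z.1) (max 0 (min 1 (z.2 - k)) * φ z.1)
    linarith [hB z, hsη z.1]
  · have : max 0 (min 1 (z.2 - k)) = 0 :=
      max_eq_left ((min_le_right _ _).trans (by linarith))
    simpa [this] using hsη z.1
  · simpa [hφ0 x hx] using hsη x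
  · by_cases hxK : x ∈ K
    · simp [hφ0 x hxK, hsK x hxK]
    · have h1 : max 0 (min 1 (f x - k)) = 1 := by
        rw [min_eq_left (by linarith [hf x hx hxK]), max_eq_right zero_le_one]
      simp only [h1, hφK x hx]
      ring

theorem exists_disjoint_finite_of_isMeagre_univ [T35Space X]
    (h : IsMeagre (Set.univ : Set {f : X → ℝ // BaireOne f})) :
    ∃ Δ : ℕ → Set X, (∀ n, (Δ n).Finite ∧ (Δ n).Nonempty) ∧
      (Pairwise fun n m => Disjoint (Δ n) (Δ m)) ∧
      ∀ f : X → ℝ, BaireOne f → ∃ M : ℝ, ∀ n, ∃ x ∈ Δ n, |f x| ≤ M := by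
  classical
  rcases finite_or_infinite X with hX | hX
  · exact (not_isMeagre_univ_of_finite h).elim
  obtain ⟨U, hUo, hUd, hUanti, hUempty⟩ := exists_antitone_dense_open_of_isMeagre_univ h
  choose next hnext happrox using fun (n : ℕ) (K : Finset X) =>
    exists_finset_uniform_approx (hUo n) (hUd n) K n (Nat.one_div_pos_of_nat (α := ℝ) (n := n))
  let K : ℕ → Finset X := fun n => Nat.rec ∅ next n
  have hKss : ∀ n, K n ⊂ K (n + 1) := fun n => hnext n (K n)
  have hKmono : Monotone K := monotone_nat_of_le_succ fun n => (hKss n).subset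
  refine ⟨fun n => ((K (n + 1) \ K n : Finset X) : Set X), fun n => ⟨Finset.finite_toSet _, ?_⟩,
    ?_, ?_⟩
  · exact Finset.coe_nonempty.2 (Finset.sdiff_nonempty.2 (hKss n).2)
  · refine (pairwise_disjoint_on _).2 fun n m hnm => Set.disjoint_left.2 fun x hx hx' => ?_
    simp only [Finset.coe_sdiff, Set.mem_sdiff, Finset.mem_coe] at hx hx'
    exact hx'.2 (hKmono hnm hx.1)
  intro f hf
  by_contra! hunb
  have hlarge : ∀ (N : ℕ) (M : ℝ), ∃ n, N ≤ n ∧ ∀ x ∈ K (n + 1), x ∉ K n → M ≤ |f x| := by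
    intro N M
    obtain ⟨n, hn⟩ := hunb (max M (∑ y ∈ K N, |f y|))
    refine ⟨n, ?_, fun x hx hx' =>
      (le_max_left _ _).trans (hn x (by simp [hx, hx'])).le⟩
    by_contra! hnN
    obtain ⟨x, hx⟩ := Finset.sdiff_nonempty.2 (hKss n).2
    have h1 := (le_max_right _ _).trans_lt (hn x hx)
    exact h1.not_ge (Finset.single_le_sum (f := fun y => |f y|) (fun _ _ => abs_nonneg _)
      (hKmono hnN (Finset.mem_sdiff.1 hx).1))
  let State := {s : (X × ℝ → ℝ) × ℕ × ℝ //
    Continuous s.1 ∧ (∃ B, ∀ z, |s.1 z| ≤ B) ∧ 0 < s.2.2}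
  have step : ∀ (k : ℕ) (s : State), ∃ s' : State,
      s.1.2.1 ≤ s'.1.2.1 ∧ s'.1.2.2 ≤ s.1.2.2 / 2 ∧
      (∀ z, z.2 ≤ (k : ℝ) → |s'.1.1 z - s.1.1 z| ≤ s.1.2.2 - s'.1.2.2) ∧
      (∀ x ∈ K s.1.2.1, ∀ t, |s'.1.1 (x, t) - s.1.1 (x, t)| ≤ s.1.2.2 - s'.1.2.2) ∧
      ∀ v : {f : X → ℝ // BaireOne f},
        (∀ x ∈ K s'.1.2.1, |v.1 x - s'.1.1 (x, |f x|)| ≤ s'.1.2.2) → v ∈ U k := by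
    rintro k ⟨⟨H, N, ε⟩, hH, ⟨B, hB⟩, hε⟩
    simp only at hH hB hε ⊢
    obtain ⟨N₁, hN₁⟩ := exists_nat_ge B
    obtain ⟨N₂, hN₂⟩ := exists_nat_one_div_lt (half_pos hε)
    obtain ⟨n, hn, hfn⟩ := hlarge (max (max N k) (max N₁ N₂)) (k + 1)
    simp only [max_le_iff] at hn
    obtain ⟨⟨hNn, hkn⟩, hn₁, hn₂⟩ := hn
    have hηε : 1 / ((n : ℝ) + 1) ≤ ε / 2 := (Nat.one_div_le_one_div hn₂).trans hN₂.le
    obtain ⟨u, δ, hδ, hu, huU⟩ := happrox n (K n) (fun x => H (x, |f x|)) fun x =>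
      (hB _).trans (hN₁.trans (by exact_mod_cast hn₁))
    obtain ⟨H', hH', hB', hlow, hK, hval⟩ := exists_corrected_function (f := fun x => |f x|) hH hB
      Nat.one_div_pos_of_nat.le (fun x hx => (hu x hx).le) (hKss n).subset hfn
    have hmin : min (ε / 2) (δ / 2) ≤ ε / 2 := min_le_left _ _
    refine ⟨⟨⟨H', n + 1, min (ε / 2) (δ / 2)⟩, hH', hB', by positivity⟩, by simp only; omega,
      hmin, fun z hz => ?_, fun x hx t => ?_, fun v hv => hUanti hkn (huU v fun x hx => ?_)⟩
    · linarith [hlow z hz]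
    · linarith [hK x (hKmono hNn hx) t]
    · have h1 := hv x hx
      simp only [hval x hx] at h1
      linarith [min_le_right (ε / 2) (δ / 2)]
  choose nextState hN hε hlow hK hU using step
  let s₀ : State := ⟨⟨0, 0, 1⟩, continuous_zero, ⟨0, by simp⟩, one_pos⟩
  let s : ℕ → State := fun k => Nat.rec s₀ nextState k
  have hNmono : Monotone fun k => (s k).1.2.1 := monotone_nat_of_le_succ fun k => hN k (s k)
  have hpos : ∀ k, 0 < (s k).1.2.2 := fun k => (s k).2.2.2
  have hgeom : ∀ k, (s k).1.2.2 ≤ (1 / 2) ^ k := by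
    intro k
    induction k with
    | zero => simp [s, s₀]
    | succ k ih =>
      have : (s (k + 1)).1.2.2 ≤ (s k).1.2.2 / 2 := hε k (s k)
      rw [pow_succ]
      linarith
  obtain ⟨L, hL, hlim⟩ := exists_continuous_limit (fun k => (s k).2.1) hpos
    (squeeze_zero (fun k => (hpos k).le) hgeom
      (tendsto_pow_atTop_nhds_zero_of_lt_one (by norm_num) (by norm_num)))
    fun k => hlow k (s k)
  have htele : ∀ k, ∀ x ∈ K (s k).1.2.1, ∀ t, ∀ j, k ≤ j →
      |(s j).1.1 (x, t) - (s k).1.1 (x, t)| ≤ (s k).1.2.2 - (s j).1.2.2 := by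
    intro k x hx t j hj
    induction j, hj using Nat.le_induction with
    | base => simp
    | succ j hj ih =>
      have h1 : |(s (j + 1)).1.1 (x, t) - (s j).1.1 (x, t)| ≤
          (s j).1.2.2 - (s (j + 1)).1.2.2 := hK j (s j) x (hKmono (hNmono hj) hx) t
      have h2 := abs_sub_le ((s (j + 1)).1.1 (x, t)) ((s j).1.1 (x, t)) ((s k).1.1 (x, t))
      linarith
  have hmem : (⟨_, hf.abs.continuous_comp hL⟩ : {f : X → ℝ // BaireOne f}) ∈ ⋂ n, U n :=
    Set.mem_iInter.2 fun k => hU k (s k) _ fun x hx =>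
      le_of_tendsto ((hlim (x, |f x|)).sub_const _).abs <|
        (eventually_ge_atTop (k + 1)).mono fun j hj => by
          have := htele (k + 1) x hx |f x| j hj
          exact this.trans (sub_le_self _ (hpos j).le)
  rw [hUempty] at hmem
  exact hmem

end BaireOneCategory

/-- For a Tychonoff space `X`, the space `B₁(X)` of Baire-one functions
(with the pointwise-convergence topology) is meager in itself iff there is a pairwise
disjoint sequence of nonempty finite subsets `Δ n ⊆ X` such that
`sup_n (min_{x ∈ Δ n} |f x|) < ∞` for every Baire-one function `f`. -/
theorem statement0 {X : Type*} [TopologicalSpace X] [T35Space X] :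
    IsMeagre (Set.univ : Set {f : X → ℝ // BaireOne f}) ↔
      ∃ Δ : ℕ → Set X,
        (∀ n, (Δ n).Finite ∧ (Δ n).Nonempty) ∧
        (Pairwise fun n m => Disjoint (Δ n) (Δ m)) ∧
        ∀ f : X → ℝ, BaireOne f → ∃ M : ℝ, ∀ n, ∃ x ∈ Δ n, |f x| ≤ M := by
  refine ⟨exists_disjoint_finite_of_isMeagre_univ, ?_⟩
  rintro ⟨Δ, hΔ, hdisj, hbdd⟩
  exact isMeagre_univ_of_bounded_min (fun n => (hΔ n).1) hdisj hbdd
end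

section
/- Let X be a Tychonoff (completely regular Hausdorff) topological space and let Y ⊆ X carry the subspace topology. If B_1(X) is a Baire space, then B_1(Y) is a Baire space. -/
open Set Topology Filter

/-- In a Tychonoff space, arbitrary real values on a finite set are interpolated by a
continuous function. -/
theorem exists_continuous_eqOn_finset {X : Type*} [TopologicalSpace X] [T35Space X]
    (S : Finset X) (v : X → ℝ) : ∃ f : X → ℝ, Continuous f ∧ ∀ x ∈ S, f x = v x := by
  classical
  have key : ∀ x : X, ∃ φ : X → ℝ, Continuous φ ∧ φ x = 1 ∧ ∀ y ∈ S, y ≠ x → φ y = 0 := by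
    intro x
    obtain ⟨f, hf, hfx, hfK⟩ := CompletelyRegularSpace.completely_regular x
      (↑(S.erase x) : Set X) (S.erase x).finite_toSet.isClosed (by simp)
    refine ⟨fun y => 1 - (f y : ℝ), by fun_prop, by simp [hfx], fun y hy hyx => ?_⟩
    have hy1 : f y = 1 := hfK (by simp [hy, hyx])
    simp [hy1]
  choose φ hφ hφ1 hφ0 using key
  refine ⟨fun y => ∑ x ∈ S, v x * φ x y,
    continuous_finsetSum _ fun x _ => continuous_const.mul (hφ x), fun y hy => ?_⟩
  beta_reduce
  rw [Finset.sum_eq_single_of_mem y hy fun x _ hxy => by rw [hφ0 x y hy hxy.symm, mul_zero],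
    hφ1, mul_one]

theorem Continuous.baireOne {X : Type*} [TopologicalSpace X] {f : X → ℝ} (hf : Continuous f) :
    BaireOne f :=
  ⟨fun _ => f, fun _ => hf, fun _ => tendsto_const_nhds⟩

theorem BaireOne.restrict {X : Type*} [TopologicalSpace X] {f : X → ℝ} (hf : BaireOne f)
    (Y : Set X) : BaireOne (Y.domRestrict f) := by
  obtain ⟨g, hg, hlim⟩ := hf
  exact ⟨fun n => Y.domRestrict (g n), fun n => (hg n).comp continuous_subtype_val, fun y => hlim y⟩

/-- Basic neighbourhoods for the topology of pointwise convergence on Baire-one functions. -/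
theorem exists_finset_of_isOpen_baireOne {X : Type*} [TopologicalSpace X]
    {U : Set {f : X → ℝ // BaireOne f}} (hU : IsOpen U) {u : {f : X → ℝ // BaireOne f}}
    (hu : u ∈ U) : ∃ (F : Finset X) (w : X → Set ℝ), (∀ x ∈ F, IsOpen (w x) ∧ u.1 x ∈ w x) ∧
      ∀ f : {f : X → ℝ // BaireOne f}, (∀ x ∈ F, f.1 x ∈ w x) → f ∈ U := by
  obtain ⟨V, hV, rfl⟩ := isOpen_induced_iff.mp hU
  obtain ⟨F, w, hw, hsub⟩ := isOpen_pi_iff.mp hV u.1 hu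
  exact ⟨F, w, hw, fun f hf => hsub hf⟩

/-- The restriction map between spaces of Baire-one functions. -/
def baireOneRestrict {X : Type*} [TopologicalSpace X] (Y : Set X)
    (f : {f : X → ℝ // BaireOne f}) : {f : Y → ℝ // BaireOne f} :=
  ⟨Y.domRestrict f.1, f.2.restrict Y⟩

theorem continuous_baireOneRestrict {X : Type*} [TopologicalSpace X] (Y : Set X) :
    Continuous (baireOneRestrict Y) := by
  refine continuous_induced_rng.mpr (continuous_pi fun y => ?_)
  exact (continuous_apply (y : X)).comp continuous_subtype_val

theorem Dense.preimage_baireOneRestrict {X : Type*} [TopologicalSpace X] [T35Space X] {Y : Set X}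
    {D : Set {f : Y → ℝ // BaireOne f}} (hD : Dense D) (hDo : IsOpen D) :
    Dense (baireOneRestrict Y ⁻¹' D) := by
  classical
  rw [dense_iff_inter_open]
  rintro U hU ⟨u, hu⟩
  obtain ⟨F, w, hw, hFU⟩ := exists_finset_of_isOpen_baireOne hU hu
  let W : Set {f : Y → ℝ // BaireOne f} :=
    ⋂ x ∈ F, {g | ∀ hx : x ∈ Y, g.1 ⟨x, hx⟩ ∈ w x}
  have hW : IsOpen W := by
    refine isOpen_biInter_finset fun x hx => ?_
    by_cases hxY : x ∈ Y
    · simpa [hxY, preimage, Function.comp_def] using (hw x hx).1.preimage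
        ((continuous_apply (⟨x, hxY⟩ : Y)).comp
          (continuous_subtype_val (p := fun f : Y → ℝ => BaireOne f)))
    · simp [hxY]
  have hWu : baireOneRestrict Y u ∈ W := mem_iInter₂.mpr fun x hx _ => (hw x hx).2
  obtain ⟨d, hdW, hdD⟩ := hD.inter_open_nonempty W hW ⟨_, hWu⟩
  obtain ⟨G, w', hw', hGD⟩ := exists_finset_of_isOpen_baireOne hDo hdD
  obtain ⟨f, hf, hfv⟩ := exists_continuous_eqOn_finset (F ∪ G.image Subtype.val)
    fun x => if hx : x ∈ Y then d.1 ⟨x, hx⟩ else u.1 x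
  refine ⟨⟨f, hf.baireOne⟩, hFU _ fun x hx => ?_, hGD _ fun y hy => ?_⟩
  · change f x ∈ w x
    rw [hfv x (Finset.mem_union_left _ hx)]
    split_ifs with hxY
    · exact mem_iInter₂.mp hdW x hx hxY
    · exact (hw x hx).2
  · change f y ∈ w' y
    rw [hfv y (Finset.mem_union_right _ (Finset.mem_image_of_mem _ hy)), dif_pos y.2]
    exact (hw' y hy).2

theorem denseRange_baireOneRestrict {X : Type*} [TopologicalSpace X] [T35Space X] (Y : Set X) :
    DenseRange (baireOneRestrict Y) := by
  classical
  refine dense_iff_inter_open.mpr ?_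
  rintro V hV ⟨d, hd⟩
  obtain ⟨G, w, hw, hGV⟩ := exists_finset_of_isOpen_baireOne hV hd
  obtain ⟨f, hf, hfv⟩ := exists_continuous_eqOn_finset (G.image Subtype.val)
    fun x => if hx : x ∈ Y then d.1 ⟨x, hx⟩ else 0
  refine ⟨baireOneRestrict Y ⟨f, hf.baireOne⟩, hGV _ fun y hy => ?_, mem_range_self _⟩
  change f y ∈ w y
  rw [hfv y (Finset.mem_image_of_mem _ hy), dif_pos y.2]
  exact (hw y hy).2

/-- If `X` is Tychonoff and `B₁(X)` is a Baire space, then for every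
subspace `Y ⊆ X` the space `B₁(Y)` is a Baire space. -/
theorem statement3 {X : Type*} [TopologicalSpace X] [T35Space X] (Y : Set X)
    (h : BaireSpace {f : X → ℝ // BaireOne f}) :
    BaireSpace {f : Y → ℝ // BaireOne f} := by
  refine ⟨fun D hDo hD => ?_⟩
  have hpre : Dense (⋂ n, baireOneRestrict Y ⁻¹' D n) :=
    dense_iInter_of_isOpen_nat (fun n => (hDo n).preimage (continuous_baireOneRestrict Y))
      fun n => (hD n).preimage_baireOneRestrict (hDo n)
  rw [← preimage_iInter] at hpre
  exact ((denseRange_baireOneRestrict Y).dense_image (continuous_baireOneRestrict Y) hpre).mono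
    (image_preimage_subset _ _)
end

section
/- Let X be a Hausdorff topological space and let {F_i : i ∈ ℕ} be a pairwise disjoint family of Coz_δ-subsets of X that is completely Coz_δ-additive. Then every real-valued function on ∪_{i∈ℕ} F_i that is constant on each F_i can be extended to a Baire-one function on X. -/
open Set Topology Filter

/-- Given zero-sets covering the space, the function taking the value `a m` at the points whose
first zero-set is the `m`-th one is Baire-one. -/
theorem baireOne_of_first_zeroSet {X : Type*} [TopologicalSpace X] {Z : ℕ → Set X}
    (hZ : ∀ m, IsZeroSet (Z m)) (a : ℕ → ℝ) {g : X → ℝ}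
    (hg : ∀ x, ∃ m, x ∈ Z m ∧ (∀ j < m, x ∉ Z j) ∧ g x = a m) : BaireOne g := by
  choose u hu hZu using hZ
  have mem_iff (m : ℕ) (x : X) : x ∈ Z m ↔ u m x = 0 := by simp [hZu m]
  let φ : ℕ → ℕ → X → ℝ := fun k m x => max 0 (1 - k * |u m x|)
  have hφ (k m : ℕ) : Continuous (φ k m) := by
    have := hu m
    fun_prop
  refine ⟨fun k x => ∑ m ∈ Finset.range k, a m * (φ k m x * ∏ j ∈ Finset.range m, (1 - φ k j x)),
    fun k => ?_, fun x => ?_⟩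
  · fun_prop
  obtain ⟨M, hM, hlt, hgx⟩ := hg x
  have one (k : ℕ) : φ k M x = 1 := by simp [φ, (mem_iff M x).1 hM]
  have zero : ∀ᶠ k : ℕ in atTop, ∀ j ∈ Finset.range M, φ k j x = 0 := by
    rw [Filter.eventually_all_finset]
    intro j hj
    have hpos : 0 < |u j x| :=
      abs_pos.2 fun h => hlt j (Finset.mem_range.1 hj) ((mem_iff j x).2 h)
    filter_upwards [(tendsto_natCast_atTop_atTop.atTop_mul_const hpos).eventually_ge_atTop 1]
      with k hk
    exact max_eq_left (by linarith)
  refine tendsto_const_nhds.congr' ?_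
  filter_upwards [zero, eventually_gt_atTop M] with k hk hMk
  rw [hgx, Finset.sum_eq_single M]
  · rw [one, Finset.prod_eq_one fun j hj => by rw [hk j hj, sub_zero]]
    simp
  · intro m _ hm
    rcases lt_or_gt_of_ne hm with h | h
    · rw [hk m (Finset.mem_range.2 h)]
      simp
    · rw [Finset.prod_eq_zero (Finset.mem_range.2 h) (by rw [one, sub_self])]
      simp
  · exact fun h => absurd (Finset.mem_range.2 hMk) h

theorem IsCozDelta.compl {X : Type*} [TopologicalSpace X] {s : Set X} (hs : IsCozDelta s) :
    IsZerSigma sᶜ := by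
  obtain ⟨F, hF, rfl⟩ := hs
  exact ⟨fun n => (F n)ᶜ, hF, compl_iInter F⟩

/-- Let `X` be Hausdorff and `F : ℕ → Set X` a pairwise disjoint,
completely Coz_δ-additive family. Then every real-valued function on `⋃ i, F i` that is
constant on each `F i` extends to a Baire-one function on `X`. -/
theorem statement6 {X : Type*} [TopologicalSpace X] [T2Space X]
    (F : ℕ → Set X) (hdisj : Pairwise fun i j => Disjoint (F i) (F j))
    (hadd : CompletelyCozDeltaAdditive F)
    (f : X → ℝ) (hconst : ∀ i, ∀ x ∈ F i, ∀ y ∈ F i, f x = f y) :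
    ∃ g : X → ℝ, BaireOne g ∧ ∀ x ∈ ⋃ i, F i, g x = f x := by
  classical
  choose Z hZ hDZ using fun n => (hadd.2 {i | i ≠ n}).compl
  have mem_iff (n : ℕ) (x : X) : (∃ k, x ∈ Z n k) ↔ ∀ i, i ≠ n → x ∉ F i := by
    rw [← mem_iUnion, ← hDZ n]
    simp
  have cover (x : X) : ∃ m : ℕ, x ∈ Z m.unpair.1 m.unpair.2 := by
    obtain ⟨n, hn⟩ : ∃ n, ∀ i, i ≠ n → x ∉ F i := by
      by_cases hx : ∃ n, x ∈ F n
      · obtain ⟨n, hn⟩ := hx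
        exact ⟨n, fun i hi hxi => (hdisj hi).le_bot ⟨hxi, hn⟩⟩
      · exact ⟨0, fun i _ hxi => hx ⟨i, hxi⟩⟩
    obtain ⟨k, hk⟩ := (mem_iff n x).2 hn
    exact ⟨Nat.pair n k, by simpa using hk⟩
  have value (n : ℕ) : ∃ c : ℝ, ∀ x ∈ F n, f x = c := by
    rcases (F n).eq_empty_or_nonempty with h | ⟨y, hy⟩
    · exact ⟨0, by simp [h]⟩
    · exact ⟨f y, fun x hx => hconst n x hx y hy⟩
  choose c hc using value
  refine ⟨fun x => c (Nat.find (cover x)).unpair.1,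
    baireOne_of_first_zeroSet (fun m => hZ m.unpair.1 m.unpair.2) (fun m => c m.unpair.1)
      fun x => ⟨Nat.find (cover x), Nat.find_spec (cover x), fun j hj => Nat.find_min _ hj, rfl⟩,
    fun x hx => ?_⟩
  obtain ⟨i, hi⟩ := mem_iUnion.1 hx
  have hin : i = (Nat.find (cover x)).unpair.1 := by
    by_contra h
    exact (mem_iff _ x).1 ⟨_, Nat.find_spec (cover x)⟩ i h hi
  rw [hc i x hi]
  exact congrArg c hin.symm
end

section
/- Let X be a Hausdorff topological space and let {F_i : i ∈ ℕ} be a pairwise disjoint family of Coz_δ-subsets of X that is completely Coz_δ-additive. Then for every family {L_i : i ∈ ℕ} of Coz_δ-subsets of X with L_i ⊆ F_i for each i, the family {L_i : i ∈ ℕ} is completely Coz_δ-additive. -/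
open Set Topology Filter

theorem IsCozeroSet.union {X : Type*} [TopologicalSpace X] {s t : Set X}
    (hs : IsCozeroSet s) (ht : IsCozeroSet t) : IsCozeroSet (s ∪ t) := by
  obtain ⟨f, hf, hfs⟩ := hs
  obtain ⟨g, hg, hgt⟩ := ht
  refine ⟨fun x => |f x| + |g x|, by fun_prop, ?_⟩
  rw [compl_union, hfs, hgt]
  ext x
  simp [add_eq_zero_iff_of_nonneg (abs_nonneg (f x)) (abs_nonneg (g x))]

theorem IsCozeroSet.isCozDelta_iInter {X ι : Type*} [TopologicalSpace X] [Countable ι]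
    [Nonempty ι] {F : ι → Set X} (hF : ∀ i, IsCozeroSet (F i)) : IsCozDelta (⋂ i, F i) := by
  obtain ⟨e, he⟩ := exists_surjective_nat ι
  exact ⟨fun n => F (e n), fun n => hF (e n), (he.iInter_comp F).symm⟩

theorem IsCozDelta.iInter {X ι : Type*} [TopologicalSpace X] [Countable ι] [Nonempty ι]
    {F : ι → Set X} (hF : ∀ i, IsCozDelta (F i)) : IsCozDelta (⋂ i, F i) := by
  choose G hG hFG using hF
  have h : ⋂ i, F i = ⋂ p : ι × ℕ, G p.1 p.2 := by
    ext x
    simp [hFG]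
  rw [h]
  exact IsCozeroSet.isCozDelta_iInter fun p => hG p.1 p.2

theorem IsCozDelta.inter {X : Type*} [TopologicalSpace X] {s t : Set X}
    (hs : IsCozDelta s) (ht : IsCozDelta t) : IsCozDelta (s ∩ t) := by
  rw [inter_eq_iInter]
  exact IsCozDelta.iInter (Bool.forall_bool.2 ⟨ht, hs⟩)

theorem IsCozDelta.union {X : Type*} [TopologicalSpace X] {s t : Set X}
    (hs : IsCozDelta s) (ht : IsCozDelta t) : IsCozDelta (s ∪ t) := by
  obtain ⟨A, hA, rfl⟩ := hs
  obtain ⟨B, hB, rfl⟩ := ht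
  have h : (⋂ n, A n) ∪ ⋂ n, B n = ⋂ p : ℕ × ℕ, A p.2 ∪ B p.1 := by
    ext x
    simp only [iInter_union, union_iInter, mem_iInter, Prod.forall]
  rw [h]
  exact IsCozeroSet.isCozDelta_iInter fun p => (hA p.2).union (hB p.1)

/-- A union of subsets `L i` of pairwise disjoint sets `F i` is cut out of the union of the `F i`
by allowing, for each `i`, only points of `L i` or of some `F j` with `j ≠ i`. -/
theorem biUnion_eq_inter_iInter_of_pairwise_disjoint {X ι : Type*} {F L : ι → Set X}
    (hdisj : Pairwise fun i j => Disjoint (F i) (F j)) (hsub : ∀ i, L i ⊆ F i) (S : Set ι) :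
    ⋃ i ∈ S, L i = (⋃ i ∈ S, F i) ∩ ⋂ i, (L i ∪ ⋃ j ∈ S \ {i}, F j) := by
  ext x
  simp only [mem_inter_iff, mem_iInter, mem_union, mem_iUnion, Set.mem_sdiff, mem_singleton_iff,
    exists_prop]
  constructor
  · rintro ⟨i, hi, hx⟩
    refine ⟨⟨i, hi, hsub i hx⟩, fun k => ?_⟩
    by_cases hik : i = k
    · exact Or.inl (hik ▸ hx)
    · exact Or.inr ⟨i, ⟨hi, hik⟩, hsub i hx⟩
  · rintro ⟨⟨i, hi, hx⟩, h⟩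
    obtain hL | ⟨j, ⟨-, hji⟩, hxj⟩ := h i
    · exact ⟨i, hi, hL⟩
    · exact (disjoint_left.1 (hdisj hji) hxj hx).elim

/-- Let `X` be Hausdorff and `F : ℕ → Set X` a pairwise disjoint,
completely Coz_δ-additive family. Then any family of Coz_δ-sets `L i ⊆ F i` is again
completely Coz_δ-additive. -/
theorem statement7 {X : Type*} [TopologicalSpace X] [T2Space X]
    (F : ℕ → Set X) (hdisj : Pairwise fun i j => Disjoint (F i) (F j))
    (hadd : CompletelyCozDeltaAdditive F)
    (L : ℕ → Set X) (hL : ∀ i, IsCozDelta (L i)) (hsub : ∀ i, L i ⊆ F i) :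
    CompletelyCozDeltaAdditive L := by
  refine ⟨hL, fun S => ?_⟩
  rw [biUnion_eq_inter_iInter_of_pairwise_disjoint hdisj hsub S]
  exact (hadd.2 S).inter (IsCozDelta.iInter fun i => (hL i).union (hadd.2 (S \ {i})))
end

section
/- Let X be a Tychonoff (completely regular Hausdorff) topological space and let (Δ_n)_{n∈ℕ} be a pairwise disjoint sequence of finite subsets of X. Then there exists a family (B_n)_{n∈ℕ} of subsets of X with Δ_n ⊆ B_n for each n, pairwise disjoint and completely Coz_δ-additive, if and only if the set ∪_{n∈ℕ} Δ_n is strongly Coz_δ-disjoint. -/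
open Set Topology Filter

theorem IsCozeroSet.empty {X : Type*} [TopologicalSpace X] : IsCozeroSet (∅ : Set X) :=
  ⟨fun _ => 0, continuous_const, by ext; simp⟩

theorem IsCozeroSet.biUnion_of_finite {X ι : Type*} [TopologicalSpace X] {I : Set ι}
    (hI : I.Finite) {U : ι → Set X} (hU : ∀ i ∈ I, IsCozeroSet (U i)) :
    IsCozeroSet (⋃ i ∈ I, U i) := by
  induction I, hI using Set.Finite.induction_on with
  | empty => simpa using IsCozeroSet.empty
  | insert _ _ ih =>
    rw [biUnion_insert]
    exact (hU _ (mem_insert _ _)).union (ih fun i hi => hU i (mem_insert_of_mem _ hi))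

theorem IsCozDelta.iInter_s8 {X : Type*} [TopologicalSpace X] {s : ℕ → Set X}
    (hs : ∀ n, IsCozDelta (s n)) : IsCozDelta (⋂ n, s n) := by
  choose F hF hsF using hs
  refine ⟨fun k => F k.unpair.1 k.unpair.2, fun k => hF _ _, ?_⟩
  rw [iInter_congr hsF]
  ext x
  simp only [mem_iInter]
  exact ⟨fun h k => h _ _, fun h i j => by simpa using h (Nat.pair i j)⟩

theorem IsCozDelta.union_isCozeroSet {X : Type*} [TopologicalSpace X] {s t : Set X}
    (hs : IsCozDelta s) (ht : IsCozeroSet t) : IsCozDelta (s ∪ t) := by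
  obtain ⟨F, hF, rfl⟩ := hs
  exact ⟨fun n => F n ∪ t, fun n => (hF n).union ht, iInter_union _ _⟩

theorem exists_isCozeroSet_mem_subset {X : Type*} [TopologicalSpace X] [CompletelyRegularSpace X]
    {U : Set X} (hU : IsOpen U) {x : X} (hx : x ∈ U) :
    ∃ V, IsCozeroSet V ∧ x ∈ V ∧ V ⊆ U := by
  obtain ⟨f, hf, hfx, hfU⟩ := CompletelyRegularSpace.completely_regular x Uᶜ
    hU.isClosed_compl (by simpa using hx)
  refine ⟨{y | (f y : ℝ) ≠ 1}, ⟨fun y => (f y : ℝ) - 1, by fun_prop, ?_⟩, by simp [hfx], ?_⟩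
  · ext y
    simp [sub_eq_zero]
  · intro y hy
    by_contra hyU
    exact hy (by simp [hfU hyU])

/-- Points of a finite set in a Tychonoff space have pairwise disjoint cozero neighbourhoods. -/
theorem Set.Finite.exists_pairwiseDisjoint_isCozeroSet {X : Type*} [TopologicalSpace X]
    [T35Space X] {s : Set X} (hs : s.Finite) :
    ∃ U : X → Set X, (∀ x, IsCozeroSet (U x) ∧ x ∈ U x) ∧ s.PairwiseDisjoint U := by
  obtain ⟨W, hW, hWs⟩ := hs.t2_separation
  choose U hU hxU hUW using fun x => exists_isCozeroSet_mem_subset (hW x).2 (hW x).1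
  exact ⟨U, fun x => ⟨hU x, hxU x⟩, hWs.mono hUW⟩

/-- Shrinking the members of a pairwise disjoint completely Coz_δ-additive sequence by
cozero-sets keeps the union a Coz_δ-set. -/
theorem CompletelyCozDeltaAdditive.isCozDelta_iUnion_inter {X : Type*} [TopologicalSpace X]
    {B V : ℕ → Set X} (hB : CompletelyCozDeltaAdditive B)
    (hdisj : Pairwise fun n m => Disjoint (B n) (B m)) (hV : ∀ n, IsCozeroSet (V n)) :
    IsCozDelta (⋃ n, B n ∩ V n) := by
  have h : ⋃ n, B n ∩ V n =
      (⋃ n ∈ (Set.univ : Set ℕ), B n) ∩ ⋂ n, ((⋃ m ∈ ({n}ᶜ : Set ℕ), B m) ∪ V n) := by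
    ext x
    simp only [mem_iUnion, mem_inter_iff, mem_iInter, mem_union, mem_univ, mem_compl_iff,
      mem_singleton_iff, exists_prop, true_and]
    constructor
    · rintro ⟨n, hn, hnV⟩
      refine ⟨⟨n, hn⟩, fun k => ?_⟩
      by_cases hk : n = k
      · exact .inr (hk ▸ hnV)
      · exact .inl ⟨n, hk, hn⟩
    · rintro ⟨⟨n, hn⟩, hx⟩
      refine ⟨n, hn, (hx n).resolve_left ?_⟩
      rintro ⟨m, hmn, hm⟩
      exact disjoint_left.1 (hdisj hmn) hm hn
  rw [h]
  exact (hB.2 _).inter (.iInter fun n => (hB.2 _).union_isCozeroSet (hV n))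

/-- For a Tychonoff space `X` and a pairwise disjoint sequence
`(Δ n)` of finite subsets of `X`: there is a pairwise disjoint, completely
Coz_δ-additive family `(B n)` with `Δ n ⊆ B n` for all `n` iff the set `⋃ n, Δ n`
is strongly Coz_δ-disjoint. -/
theorem statement8 {X : Type*} [TopologicalSpace X] [T35Space X]
    (Δ : ℕ → Set X) (hfin : ∀ n, (Δ n).Finite)
    (hdisj : Pairwise fun n m => Disjoint (Δ n) (Δ m)) :
    (∃ B : ℕ → Set X, (∀ n, Δ n ⊆ B n) ∧
        (Pairwise fun n m => Disjoint (B n) (B m)) ∧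
        CompletelyCozDeltaAdditive B) ↔
      StronglyCozDeltaDisjoint (⋃ n, Δ n) := by
  constructor
  · rintro ⟨B, hΔB, hBdisj, hB⟩
    choose U hU hUdisj using fun n => (hfin n).exists_pairwiseDisjoint_isCozeroSet
    choose N hN using fun a : ↥(⋃ n, Δ n) => mem_iUnion.1 a.2
    have key : ∀ S : Set ↥(⋃ n, Δ n), IsCozDelta (⋃ a ∈ S, B (N a) ∩ U (N a) a) := by
      intro S
      have hN' : ∀ (a : ↥(⋃ n, Δ n)) {n}, (a : X) ∈ Δ n → N a = n := fun a n ha => by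
        by_contra hne
        exact disjoint_left.1 (hdisj hne) (hN a) ha
      have h : ⋃ a ∈ S, B (N a) ∩ U (N a) a =
          ⋃ n, B n ∩ ⋃ x ∈ Δ n ∩ Subtype.val '' S, U n x := by
        ext x
        simp only [mem_iUnion, mem_inter_iff, exists_prop]
        constructor
        · rintro ⟨a, ha, hxB, hxU⟩
          exact ⟨N a, hxB, a, ⟨hN a, mem_image_of_mem _ ha⟩, hxU⟩
        · rintro ⟨n, hxB, _, ⟨haΔ, a, ha, rfl⟩, hxU⟩
          obtain rfl := hN' a haΔ
          exact ⟨a, ha, hxB, hxU⟩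
      rw [h]
      exact hB.isCozDelta_iUnion_inter hBdisj fun n =>
        .biUnion_of_finite ((hfin n).inter_of_left _) fun x _ => (hU n x).1
    refine ⟨fun a => B (N a) ∩ U (N a) a, fun a => ⟨hΔB _ (hN a), (hU _ _).2⟩, ?_, ?_, key⟩
    · intro a b hab
      by_cases h : N a = N b
      · have hd := hUdisj (N a) (hN a) (h ▸ hN b) (Subtype.coe_ne_coe.2 hab)
        rw [Function.onFun] at hd
        exact (h ▸ hd : Disjoint (U (N a) a) (U (N b) b)).mono inter_subset_right
          inter_subset_right
      · exact (hBdisj h).mono inter_subset_left inter_subset_left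
    · intro a
      simpa using key {a}
  · rintro ⟨F, hmem, hFdisj, -, hF⟩
    have hS : ∀ S : Set ℕ, ⋃ n ∈ S, ⋃ a ∈ {a : ↥(⋃ n, Δ n) | (a : X) ∈ Δ n}, F a =
        ⋃ a ∈ {a : ↥(⋃ n, Δ n) | ∃ n ∈ S, (a : X) ∈ Δ n}, F a := by
      intro S
      ext x
      simp only [mem_iUnion, mem_ofPred_eq, exists_prop]
      constructor
      · rintro ⟨n, hn, a, ha, hx⟩
        exact ⟨a, ⟨n, hn, ha⟩, hx⟩
      · rintro ⟨a, ⟨n, hn, ha⟩, hx⟩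
        exact ⟨n, hn, a, ha, hx⟩
    refine ⟨fun n => ⋃ a ∈ {a : ↥(⋃ n, Δ n) | (a : X) ∈ Δ n}, F a, fun n x hx => ?_, ?_,
      fun n => hF _, fun S => hS S ▸ hF _⟩
    · exact mem_biUnion (x := ⟨x, mem_iUnion.2 ⟨n, hx⟩⟩) hx (hmem _)
    · intro n m hnm
      simp only [disjoint_iUnion_left, disjoint_iUnion_right]
      intro b hb a ha
      refine hFdisj ?_
      rintro rfl
      exact disjoint_left.1 (hdisj hnm) (by assumption) (by assumption)
end
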